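/- Let n ≥ 2 be an even integer and let F : F_2^n → F_2^n be a plateaued APN function. Then the number of nonzero v ∈ F_2^n for which the component function x ↦ v·F(x) is bent is congruent to 2 modulo 4. -/

import Mathlib

open Finset

/-- The dot product on `F_2^n`. -/
def dotp {n : ℕ} (v x : Fin n → ZMod 2) : ZMod 2 := ∑ i, v i * x i

/-- A Boolean function on `F_2^n` is bent if all its Walsh values square to `2^n`. -/
def IsBent {n : ℕ} (f : (Fin n → ZMod 2) → ZMod 2) : Prop :=
  ∀ u : Fin n → ZMod 2,
    (∑ x : Fin n → ZMod 2, (-1 : ℤ) ^ (f x + dotp u x).val) ^ 2 = 2 ^ n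

/-- The extended Walsh transform of `F : F_2^n → F_2^n` at `(u, v)`. -/
def walshF {n : ℕ} (F : (Fin n → ZMod 2) → (Fin n → ZMod 2))
    (u v : Fin n → ZMod 2) : ℤ :=
  ∑ x : Fin n → ZMod 2, (-1 : ℤ) ^ (dotp v (F x) + dotp u x).val

/-- `F` is APN: every derivative equation has at most 2 solutions. -/
def IsAPN {n : ℕ} (F : (Fin n → ZMod 2) → (Fin n → ZMod 2)) : Prop :=
  ∀ a : Fin n → ZMod 2, a ≠ 0 → ∀ b : Fin n → ZMod 2,
    Nat.card {x : Fin n → ZMod 2 // F (x + a) + F x = b} ≤ 2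

/-- `F` is plateaued: every nonzero component is plateaued of some amplitude. -/
def IsPlateaued {n : ℕ} (F : (Fin n → ZMod 2) → (Fin n → ZMod 2)) : Prop :=
  ∀ v : Fin n → ZMod 2, v ≠ 0 → ∃ t : ℕ, t ≤ n ∧
    ∀ u : Fin n → ZMod 2, (walshF F u v) ^ 2 = 0 ∨ (walshF F u v) ^ 2 = 2 ^ (n + t)

/-- The sign character of `ZMod 2`. -/
def signChar (a : ZMod 2) : ℤ := (-1) ^ a.val

lemma signChar_add (a b : ZMod 2) : signChar (a + b) = signChar a * signChar b := by
  revert a b; decide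

lemma signChar_sq (a : ZMod 2) : signChar a ^ 2 = 1 := by
  revert a; decide

@[simp] lemma signChar_zero : signChar 0 = 1 := by decide

@[simp] lemma zero_dotp {n : ℕ} (x : Fin n → ZMod 2) : dotp 0 x = 0 := by simp [dotp]

@[simp] lemma dotp_zero {n : ℕ} (v : Fin n → ZMod 2) : dotp v 0 = 0 := by simp [dotp]

lemma dotp_add {n : ℕ} (v x y : Fin n → ZMod 2) : dotp v (x + y) = dotp v x + dotp v y := by
  simp [dotp, mul_add, sum_add_distrib]

lemma add_dotp {n : ℕ} (u v x : Fin n → ZMod 2) : dotp (u + v) x = dotp u x + dotp v x := by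
  simp [dotp, add_mul, sum_add_distrib]

lemma vec_add_self {n : ℕ} (x : Fin n → ZMod 2) : x + x = 0 := by
  funext i; exact CharTwo.add_self_eq_zero (x i)

lemma vec_add_eq_zero_iff {n : ℕ} (x y : Fin n → ZMod 2) : x + y = 0 ↔ y = x := by
  constructor
  · intro h
    exact add_left_cancel (h.trans (vec_add_self x).symm)
  · rintro rfl
    exact vec_add_self _

lemma card_vec (n : ℕ) : Fintype.card (Fin n → ZMod 2) = 2 ^ n := by simp [ZMod.card]

lemma sum_signChar_dotp {n : ℕ} (x : Fin n → ZMod 2) :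
    ∑ u : Fin n → ZMod 2, signChar (dotp u x) = if x = 0 then 2 ^ n else 0 := by
  split_ifs with hx
  · subst hx
    simp [ZMod.card]
  · obtain ⟨i, hi⟩ := Function.ne_iff.mp hx
    have hi1 : x i = 1 := by
      have key : ∀ a : ZMod 2, a ≠ 0 → a = 1 := by decide
      exact key _ hi
    have hd : dotp (Pi.single i 1) x = 1 := by
      simp [dotp, Pi.single_apply, hi1]
    have hneg : signChar (1 : ZMod 2) = -1 := by decide
    have h := Equiv.sum_comp (Equiv.addRight (Pi.single i (1 : ZMod 2)))
      (fun u : Fin n → ZMod 2 => signChar (dotp u x))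
    simp only [Equiv.coe_addRight, add_dotp, hd, signChar_add, hneg, mul_neg, mul_one,
      sum_neg_distrib] at h
    linarith

/-- Parseval's identity for the Fourier transform on `F_2^n`. -/
lemma parseval {n : ℕ} (g : (Fin n → ZMod 2) → ℤ) :
    ∑ u : Fin n → ZMod 2, (∑ a, signChar (dotp u a) * g a) ^ 2 = 2 ^ n * ∑ a, g a ^ 2 := by
  calc ∑ u : Fin n → ZMod 2, (∑ a, signChar (dotp u a) * g a) ^ 2
      = ∑ u : Fin n → ZMod 2, ∑ a, ∑ b, g a * g b * signChar (dotp u (a + b)) := by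
        refine sum_congr rfl fun u _ => ?_
        rw [sq, sum_mul_sum]
        refine sum_congr rfl fun a _ => sum_congr rfl fun b _ => ?_
        rw [dotp_add, signChar_add]
        ring
    _ = ∑ a, ∑ b, g a * g b * ∑ u : Fin n → ZMod 2, signChar (dotp u (a + b)) := by
        rw [sum_comm]
        refine sum_congr rfl fun a _ => ?_
        rw [sum_comm]
        simp only [mul_sum]
    _ = 2 ^ n * ∑ a, g a ^ 2 := by
        rw [mul_sum]
        refine sum_congr rfl fun a _ => ?_
        simp only [sum_signChar_dotp, vec_add_eq_zero_iff, mul_ite, mul_zero]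
        rw [sum_ite_eq' univ a]
        simp only [mem_univ, if_true]
        ring

lemma walshF_eq {n : ℕ} (F : (Fin n → ZMod 2) → (Fin n → ZMod 2)) (u v : Fin n → ZMod 2) :
    walshF F u v = ∑ x, signChar (dotp u x) * signChar (dotp v (F x)) := by
  refine sum_congr rfl fun x _ => ?_
  rw [mul_comm, ← signChar_add]
  rfl

lemma sum_walshF_sq {n : ℕ} (F : (Fin n → ZMod 2) → (Fin n → ZMod 2)) (v : Fin n → ZMod 2) :
    ∑ u, walshF F u v ^ 2 = 2 ^ n * 2 ^ n := by
  simp only [walshF_eq, parseval, signChar_sq]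
  simp [ZMod.card]

/-- The autocorrelation at `a` of the component of `F` at `v`. -/
def autocorr {n : ℕ} (F : (Fin n → ZMod 2) → (Fin n → ZMod 2)) (v a : Fin n → ZMod 2) : ℤ :=
  ∑ x, signChar (dotp v (F (x + a) + F x))

lemma walshF_sq {n : ℕ} (F : (Fin n → ZMod 2) → (Fin n → ZMod 2)) (u v : Fin n → ZMod 2) :
    walshF F u v ^ 2 = ∑ a, signChar (dotp u a) * autocorr F v a := by
  simp only [autocorr, mul_sum]
  rw [sum_comm, sq, walshF_eq, sum_mul_sum]
  refine sum_congr rfl fun x _ => ?_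
  rw [← Equiv.sum_comp (Equiv.addLeft x)]
  refine sum_congr rfl fun a _ => ?_
  simp only [Equiv.coe_addLeft, dotp_add, signChar_add]
  linear_combination (signChar (dotp u a) * signChar (dotp v (F x)) *
    signChar (dotp v (F (x + a)))) * signChar_sq (dotp u x)

lemma sum_walshF_pow_four {n : ℕ} (F : (Fin n → ZMod 2) → (Fin n → ZMod 2))
    (v : Fin n → ZMod 2) :
    ∑ u, (walshF F u v ^ 2) ^ 2 = 2 ^ n * ∑ a, autocorr F v a ^ 2 := by
  simp only [walshF_sq, parseval]

/-- The number of solutions of the derivative equation `F (x + a) + F x = b`. -/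
def derivCount {n : ℕ} (F : (Fin n → ZMod 2) → (Fin n → ZMod 2)) (a b : Fin n → ZMod 2) : ℕ :=
  #{x | F (x + a) + F x = b}

lemma sum_derivCount {n : ℕ} (F : (Fin n → ZMod 2) → (Fin n → ZMod 2)) (a : Fin n → ZMod 2) :
    ∑ b, derivCount F a b = 2 ^ n := by
  rw [← card_vec n, ← card_univ]
  exact (card_eq_sum_card_fiberwise fun _ _ => mem_univ _).symm

lemma autocorr_eq {n : ℕ} (F : (Fin n → ZMod 2) → (Fin n → ZMod 2)) (v a : Fin n → ZMod 2) :
    autocorr F v a = ∑ b, signChar (dotp v b) * (derivCount F a b : ℤ) := by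
  rw [autocorr, ← sum_fiberwise univ fun x => F (x + a) + F x]
  refine sum_congr rfl fun b _ => ?_
  rw [sum_congr rfl fun x hx => by rw [(mem_filter.mp hx).2], sum_const, derivCount, nsmul_eq_mul,
    mul_comm]

lemma sum_autocorr_zero_sq {n : ℕ} (F : (Fin n → ZMod 2) → (Fin n → ZMod 2)) :
    ∑ v, autocorr F v 0 ^ 2 = 2 ^ n * (2 ^ n) ^ 2 := by
  simp [autocorr, vec_add_self, ZMod.card]

lemma IsAPN.derivCount_sq {n : ℕ} {F : (Fin n → ZMod 2) → (Fin n → ZMod 2)} (hF : IsAPN F)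
    {a : Fin n → ZMod 2} (ha : a ≠ 0) (b : Fin n → ZMod 2) :
    derivCount F a b ^ 2 = 2 * derivCount F a b := by
  have hle : derivCount F a b ≤ 2 := by
    simpa [derivCount, Nat.card_eq_fintype_card, Fintype.card_subtype] using hF a ha b
  have hne : derivCount F a b ≠ 1 := by
    intro h
    obtain ⟨x, hx⟩ := card_eq_one.mp h
    have hmem : F (x + a) + F x = b := by
      have : x ∈ ({x | F (x + a) + F x = b} : Finset _) := hx ▸ mem_singleton_self x
      simpa using this
    have hshift : x + a ∈ ({x | F (x + a) + F x = b} : Finset _) := by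
      simp only [mem_filter, mem_univ, true_and, add_assoc, vec_add_self, add_zero]
      rwa [add_comm]
    rw [hx, mem_singleton] at hshift
    exact ha (by simpa using hshift)
  interval_cases derivCount F a b <;> simp_all

lemma IsAPN.sum_autocorr_sq {n : ℕ} {F : (Fin n → ZMod 2) → (Fin n → ZMod 2)} (hF : IsAPN F)
    {a : Fin n → ZMod 2} (ha : a ≠ 0) :
    ∑ v, autocorr F v a ^ 2 = 2 ^ n * (2 * 2 ^ n) := by
  simp only [autocorr_eq, parseval]
  have h : ∑ b, derivCount F a b ^ 2 = 2 * 2 ^ n := by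
    simp only [hF.derivCount_sq ha, ← mul_sum, sum_derivCount]
  exact_mod_cast congrArg (2 ^ n * ·) h

/-- The fourth moment of the Walsh transform of an APN function. -/
lemma IsAPN.sum_walshF_pow_four {n : ℕ} {F : (Fin n → ZMod 2) → (Fin n → ZMod 2)}
    (hF : IsAPN F) :
    ∑ v with v ≠ 0, ∑ u, (walshF F u v ^ 2) ^ 2 = (2 ^ n) ^ 3 * (2 * 2 ^ n - 2) := by
  have hzero : ∑ u, (walshF F u 0 ^ 2) ^ 2 = (2 ^ n) ^ 4 := by
    rw [_root_.sum_walshF_pow_four]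
    simp [autocorr, ZMod.card]
    ring
  have htotal : ∑ v, ∑ u, (walshF F u v ^ 2) ^ 2 =
      2 ^ n * (2 ^ n * (2 ^ n) ^ 2 + (2 ^ n - 1) * (2 ^ n * (2 * 2 ^ n))) := by
    simp only [_root_.sum_walshF_pow_four, ← mul_sum]
    rw [sum_comm, Fintype.sum_eq_add_sum_compl 0, sum_autocorr_zero_sq,
      sum_congr rfl fun a ha => hF.sum_autocorr_sq (by simpa using ha), sum_const, card_compl,
      card_vec, card_singleton, nsmul_eq_mul, Nat.cast_sub Nat.one_le_two_pow]
    push_cast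
    rfl
  have hsplit := sum_filter_add_sum_filter_not univ (fun v : Fin n → ZMod 2 => v ≠ 0)
    fun v => ∑ u, (walshF F u v ^ 2) ^ 2
  have hsingle : ({v | ¬ v ≠ 0} : Finset (Fin n → ZMod 2)) = {0} := by
    ext v; simp
  rw [hsingle, sum_singleton, hzero, htotal] at hsplit
  linear_combination hsplit

lemma even_of_sq_eq_two_pow {w : ℤ} {m : ℕ} (h : w ^ 2 = 2 ^ m) : Even m := by
  have hnat : w.natAbs ^ 2 = 2 ^ m := by
    zify
    rwa [sq_abs]
  obtain ⟨j, -, hj⟩ := (Nat.dvd_prime_pow Nat.prime_two).mp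
    (hnat ▸ dvd_pow_self w.natAbs two_ne_zero)
  rw [hj, ← pow_mul] at hnat
  exact ⟨j, by have := Nat.pow_right_injective le_rfl hnat; omega⟩

open Classical in
lemma IsPlateaued.exists_sum_walshF_pow_four {n : ℕ} (hn : Even n)
    {F : (Fin n → ZMod 2) → (Fin n → ZMod 2)} (hF : IsPlateaued F) {v : Fin n → ZMod 2}
    (hv : v ≠ 0) :
    ∃ e : ℤ, ∑ u, (walshF F u v ^ 2) ^ 2 = (2 ^ n) ^ 3 * e ∧
      e ≡ (if IsBent fun x => dotp v (F x) then 1 else 0) [ZMOD 4] := by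
  obtain ⟨t, -, ht⟩ := hF v hv
  have hparseval := sum_walshF_sq F v
  obtain ⟨u₀, hu₀⟩ : ∃ u, walshF F u v ^ 2 = 2 ^ (n + t) := by
    by_contra! hne
    rw [sum_eq_zero fun u _ => (ht u).resolve_right (hne u)] at hparseval
    have : (0 : ℤ) < 2 ^ n * 2 ^ n := by positivity
    omega
  have hteven : Even t := (Nat.even_add.mp (even_of_sq_eq_two_pow hu₀)).mp hn
  refine ⟨2 ^ t, ?_, ?_⟩
  · have hsq : ∀ u, (walshF F u v ^ 2) ^ 2 = 2 ^ (n + t) * walshF F u v ^ 2 := by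
      intro u
      rcases ht u with h | h <;> rw [h] <;> ring
    simp only [hsq, ← mul_sum, hparseval]
    ring
  · have hbent : (IsBent fun x => dotp v (F x)) ↔ t = 0 := by
      change (∀ u, walshF F u v ^ 2 = 2 ^ n) ↔ t = 0
      constructor
      · intro h
        have := Int.pow_right_injective (a := 2) (by simp) ((h u₀).symm.trans hu₀)
        omega
      · rintro rfl
        have hle : ∀ u ∈ univ, walshF F u v ^ 2 ≤ 2 ^ n := by
          intro u _
          rcases ht u with h | h <;> rw [h]
          · positivity
          · simp
        have hsum : ∑ u, walshF F u v ^ 2 = ∑ _u : Fin n → ZMod 2, (2 : ℤ) ^ n := by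
          rw [hparseval, sum_const, card_univ, card_vec, nsmul_eq_mul]
          push_cast
          rfl
        exact fun u => (sum_eq_sum_iff_of_le hle).mp hsum u (mem_univ u)
    rw [if_congr hbent rfl rfl]
    obtain ⟨k, rfl⟩ := hteven
    rcases k with _ | k
    · simp [Int.ModEq]
    · rw [if_neg (by omega)]
      exact (Int.modEq_zero_iff_dvd).mpr ⟨2 ^ (k + k), by ring⟩

theorem stmt_3 (n : ℕ) (hn : 2 ≤ n) (hneven : Even n)
    (F : (Fin n → ZMod 2) → (Fin n → ZMod 2))
    (hAPN : IsAPN F) (hPlat : IsPlateaued F) :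
    Nat.card {v : Fin n → ZMod 2 // v ≠ 0 ∧ IsBent fun x => dotp v (F x)} % 4 = 2 := by
  classical
  have hexists (v : Fin n → ZMod 2) : ∃ e : ℤ, v ≠ 0 →
      ∑ u, (walshF F u v ^ 2) ^ 2 = (2 ^ n) ^ 3 * e ∧
        e ≡ (if IsBent fun x => dotp v (F x) then 1 else 0) [ZMOD 4] := by
    by_cases hv : v = 0
    · exact ⟨0, fun h => absurd hv h⟩
    · obtain ⟨e, he⟩ := hPlat.exists_sum_walshF_pow_four hneven hv
      exact ⟨e, fun _ => he⟩
  choose e he using hexists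
  have hsum : ∑ v with v ≠ 0, e v = 2 * 2 ^ n - 2 := by
    have h := hAPN.sum_walshF_pow_four
    rw [sum_congr rfl fun v hv => (he v (mem_filter.mp hv).2).1, ← mul_sum] at h
    exact mul_left_cancel₀ (by positivity) h
  have hmod : ∑ v with v ≠ 0, e v ≡
      ∑ v with v ≠ 0, (if IsBent fun x => dotp v (F x) then 1 else 0) [ZMOD 4] := by
    refine Int.ModEq.sum fun v hv => (he v (mem_filter.mp hv).2).2
  rw [sum_boole, filter_filter, hsum] at hmod
  rw [Nat.card_eq_fintype_card, Fintype.card_subtype]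
  obtain ⟨m, rfl⟩ := Nat.exists_eq_add_of_le hn
  rw [pow_add] at hmod
  unfold Int.ModEq at hmod
  omega
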